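/- For all natural numbers m ≥ 1 and n ≥ 1, the real number 𝓛^{(m)}_n = (1/m)·Σ_{t=1}^{⌊m/2⌋} (2·cos((2t−1)π/(2m)))^{2n} satisfies 𝓛^{(m)}_n = C(2n−1, n−1) + Σ_{j≥1} (−1)^j · C(2n, n+jm), where the sum is over all j ≥ 1 with jm ≤ n (all further terms vanish). -/

import Mathlib

theorem two_mul_cos_pow_eq_sum (n : ℕ) (θ : ℝ) :
    (2 * Real.cos θ) ^ n =
      ∑ k ∈ Finset.range (n + 1), (n.choose k : ℝ) * Real.cos ((2 * k - n) * θ) := by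
  have h : ((2 * Real.cos θ) ^ n : ℂ) =
      ∑ k ∈ Finset.range (n + 1),
        ((n.choose k : ℝ) : ℂ) * Complex.exp (((2 * k - n) * θ : ℝ) * Complex.I) := by
    rw [Complex.ofReal_cos, Complex.two_cos, add_pow]
    refine Finset.sum_congr rfl fun k hk => ?_
    have hk' : k ≤ n := Nat.lt_succ_iff.mp (Finset.mem_range.mp hk)
    rw [← Complex.exp_nat_mul, ← Complex.exp_nat_mul, ← Complex.exp_add, mul_comm]
    push_cast [Nat.cast_sub hk']
    congr 2
    ring
  have h' := congrArg Complex.re h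
  simp only [Complex.re_sum, Complex.re_ofReal_mul, Complex.exp_ofReal_mul_I_re] at h'
  rw [← h']
  norm_cast

theorem two_mul_cos_pow_two_mul_eq_sum (n : ℕ) (θ : ℝ) :
    (2 * Real.cos θ) ^ (2 * n) = ((2 * n).choose n : ℝ) +
      2 * ∑ r ∈ Finset.Icc 1 n, ((2 * n).choose (n + r) : ℝ) * Real.cos (2 * r * θ) := by
  rw [two_mul_cos_pow_eq_sum, show 2 * n + 1 = n + (n + 1) by ring, Finset.sum_range_add,
    Finset.sum_range_succ' (fun x => _ * _), ← Finset.sum_range_reflect,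
    ← Finset.Ico_add_one_right_eq_Icc, Finset.sum_Ico_eq_sum_range]
  have h : ∀ j ∈ Finset.range n,
      ((2 * n).choose (n - 1 - j) : ℝ) * Real.cos ((2 * (n - 1 - j : ℕ) - (2 * n : ℕ)) * θ) =
      ((2 * n).choose (n + (1 + j)) : ℝ) * Real.cos (2 * (1 + j : ℕ) * θ) := by
    intro j hj
    have hj' := Finset.mem_range.mp hj
    rw [← Nat.choose_symm_of_eq_add (show 2 * n = (n + (1 + j)) + (n - 1 - j) by omega),
      ← Real.cos_neg, Nat.sub_sub, Nat.cast_sub (by omega)]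
    congr 2
    push_cast
    ring
  rw [Finset.sum_congr rfl h, two_mul, add_tsub_cancel_right]
  have h' : ∀ j ∈ Finset.range n,
      ((n + n).choose (n + (j + 1)) : ℝ) *
        Real.cos ((2 * (n + (j + 1) : ℕ) - (n + n : ℕ)) * θ) =
      ((n + n).choose (n + (1 + j)) : ℝ) * Real.cos (2 * (1 + j : ℕ) * θ) := by
    intro j _
    rw [add_comm j 1]
    congr 2
    push_cast
    ring
  rw [Finset.sum_congr rfl h']
  have h0 : Real.cos ((2 * (n + 0 : ℕ) - (n + n : ℕ)) * θ) = 1 := by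
    rw [← Real.cos_zero]
    congr 1
    push_cast
    ring
  rw [h0, add_zero, mul_one]
  ring

theorem two_mul_sin_mul_sum_cos_odd_mul (m : ℕ) (x : ℝ) :
    2 * Real.sin x * ∑ t ∈ Finset.range m, Real.cos ((2 * t + 1) * x) = Real.sin (2 * m * x) := by
  induction m with
  | zero => simp
  | succ m ih =>
    rw [Finset.sum_range_succ, mul_add, ih,
      show 2 * (m : ℝ) * x = (2 * m + 1) * x - x by ring,
      show 2 * ((m + 1 : ℕ) : ℝ) * x = (2 * m + 1) * x + x by push_cast; ring,
      Real.sin_add, Real.sin_sub]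
    ring

theorem sum_cos_odd_mul_pi_div_of_not_dvd {m r : ℕ} (hm : m ≠ 0) (h : ¬ m ∣ r) :
    ∑ t ∈ Finset.range m, Real.cos ((2 * t + 1) * (r * Real.pi / m)) = 0 := by
  have hm' : (m : ℝ) ≠ 0 := Nat.cast_ne_zero.mpr hm
  have hs : Real.sin (r * Real.pi / m) ≠ 0 := by
    intro hs
    obtain ⟨k, hk⟩ := Real.sin_eq_zero_iff.mp hs
    have hk' : (r : ℝ) = m * k := by
      have := Real.pi_ne_zero
      field_simp at hk
      linarith
    exact h (Int.natCast_dvd_natCast.mp ⟨k, by exact_mod_cast hk'⟩)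
  have key := two_mul_sin_mul_sum_cos_odd_mul m (r * Real.pi / m)
  rw [show 2 * (m : ℝ) * (r * Real.pi / m) = (2 * r : ℕ) * Real.pi by push_cast; field_simp,
    Real.sin_nat_mul_pi] at key
  exact (mul_eq_zero.mp key).resolve_left (mul_ne_zero two_ne_zero hs)

theorem sum_cos_odd_mul_pi_div_of_mul {m : ℕ} (hm : m ≠ 0) (j : ℕ) :
    ∑ t ∈ Finset.range m, Real.cos ((2 * t + 1) * ((j * m : ℕ) * Real.pi / m)) =
      m * (-1) ^ j := by
  have hm' : (m : ℝ) ≠ 0 := Nat.cast_ne_zero.mpr hm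
  rw [Finset.sum_congr rfl (g := fun _ => (-1 : ℝ) ^ j), Finset.sum_const, Finset.card_range,
    nsmul_eq_mul]
  intro t _
  rw [show (2 * (t : ℝ) + 1) * ((j * m : ℕ) * Real.pi / m) =
    ((2 * t + 1) * j : ℕ) * Real.pi by push_cast; field_simp, Real.cos_nat_mul_pi, pow_mul,
    Odd.neg_one_pow ⟨t, rfl⟩]

theorem sum_choose_mul_sum_cos {m : ℕ} (hm : m ≠ 0) (n : ℕ) :
    ∑ r ∈ Finset.Icc 1 n, ((2 * n).choose (n + r) : ℝ) *
        ∑ t ∈ Finset.range m, Real.cos ((2 * t + 1) * (r * Real.pi / m)) =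
      m * ∑ j ∈ (Finset.Icc 1 n).filter (fun j => j * m ≤ n),
        (-1 : ℝ) ^ j * (2 * n).choose (n + j * m) := by
  have hm1 : 1 ≤ m := Nat.one_le_iff_ne_zero.mpr hm
  rw [← Finset.sum_filter_of_ne (p := fun r => m ∣ r), Finset.mul_sum]
  · symm
    refine Finset.sum_bij (fun j _ => j * m) ?_ ?_ ?_ ?_
    · intro j hj
      simp only [Finset.mem_filter, Finset.mem_Icc] at hj ⊢
      exact ⟨⟨Nat.mul_pos hj.1.1 hm1, hj.2⟩, dvd_mul_left m j⟩
    · intro a _ b _ hab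
      exact Nat.eq_of_mul_eq_mul_right hm1 hab
    · intro r hr
      simp only [Finset.mem_filter, Finset.mem_Icc] at hr
      obtain ⟨⟨h1, h2⟩, j, rfl⟩ := hr
      refine ⟨j, ?_, mul_comm j m⟩
      simp only [Finset.mem_filter, Finset.mem_Icc]
      refine ⟨⟨Nat.pos_of_mul_pos_left h1, ?_⟩, by rwa [mul_comm]⟩
      exact (Nat.le_mul_of_pos_left j hm1).trans h2
    · intro j _
      rw [sum_cos_odd_mul_pi_div_of_mul hm]
      ring
  · intro r _ hne
    by_contra h
    exact hne (by rw [sum_cos_odd_mul_pi_div_of_not_dvd hm h, mul_zero])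

theorem sum_range_eq_two_mul_sum_half {m : ℕ} {f : ℕ → ℝ}
    (hf : ∀ t < m, f (m - 1 - t) = f t) (hmid : ∀ t, m = 2 * t + 1 → f t = 0) :
    ∑ t ∈ Finset.range m, f t = 2 * ∑ t ∈ Finset.range (m / 2), f t := by
  obtain ⟨h, rfl | rfl⟩ := m.even_or_odd'
  · rw [Nat.mul_div_cancel_left h two_pos, two_mul, Finset.sum_range_add, two_mul]
    congr 1
    rw [← Finset.sum_range_reflect]
    refine Finset.sum_congr rfl fun t ht => ?_
    have ht' := Finset.mem_range.mp ht
    rw [← hf t (by omega)]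
    congr 1
    omega
  · rw [show (2 * h + 1) / 2 = h by omega, show 2 * h + 1 = (h + 1) + h by ring,
      Finset.sum_range_add, Finset.sum_range_succ, hmid h rfl, add_zero, two_mul]
    congr 1
    rw [← Finset.sum_range_reflect]
    refine Finset.sum_congr rfl fun t ht => ?_
    have ht' := Finset.mem_range.mp ht
    rw [← hf t (by omega)]
    congr 1
    omega

theorem sum_two_mul_cos_pow_half {m n : ℕ} (hm : m ≠ 0) (hn : n ≠ 0) :
    ∑ t ∈ Finset.range m, (2 * Real.cos ((2 * t + 1) * Real.pi / (2 * m))) ^ (2 * n) =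
      2 * ∑ t ∈ Finset.range (m / 2),
        (2 * Real.cos ((2 * t + 1) * Real.pi / (2 * m))) ^ (2 * n) := by
  have hm' : (m : ℝ) ≠ 0 := Nat.cast_ne_zero.mpr hm
  refine sum_range_eq_two_mul_sum_half (fun t ht => ?_) fun t ht => ?_
  · rw [show (2 * ((m - 1 - t : ℕ) : ℝ) + 1) * Real.pi / (2 * m) =
        Real.pi - (2 * t + 1) * Real.pi / (2 * m) by
      rw [Nat.sub_sub, Nat.cast_sub (by omega)]
      push_cast
      field_simp
      ring, Real.cos_pi_sub, mul_neg, Even.neg_pow (even_two_mul n)]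
  · rw [show (2 * (t : ℝ) + 1) * Real.pi / (2 * m) = Real.pi / 2 by
      have : (m : ℝ) = 2 * t + 1 := by exact_mod_cast ht
      rw [← this]
      field_simp, Real.cos_pi_div_two, mul_zero, zero_pow (by omega)]

open Real

theorem calL_eq (m : ℕ) (hm : 1 ≤ m) (n : ℕ) (hn : 1 ≤ n) :
    (1 / m : ℝ) *
        ∑ t ∈ Finset.Icc 1 (m / 2), (2 * Real.cos ((2 * t - 1 : ℕ) * π / (2 * m))) ^ (2 * n) =
      Nat.choose (2 * n - 1) (n - 1) +
        ∑ j ∈ (Finset.Icc 1 n).filter (fun j => j * m ≤ n),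
          (-1 : ℝ) ^ j * Nat.choose (2 * n) (n + j * m) := by
  have hm0 : m ≠ 0 := by omega
  have hm' : (m : ℝ) ≠ 0 := Nat.cast_ne_zero.mpr hm0
  have hchoose : ((2 * n).choose n : ℝ) = 2 * (2 * n - 1).choose (n - 1) := by
    obtain ⟨k, rfl⟩ := Nat.exists_eq_add_of_le' hn
    rw [show 2 * (k + 1) = 2 * k + 1 + 1 by ring, Nat.choose_succ_succ', Nat.add_sub_cancel,
      Nat.add_sub_cancel, Nat.choose_symm_half]
    push_cast
    ring
  have hshift : ∑ t ∈ Finset.Icc 1 (m / 2),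
        (2 * Real.cos ((2 * t - 1 : ℕ) * π / (2 * m))) ^ (2 * n) =
      ∑ t ∈ Finset.range (m / 2), (2 * Real.cos ((2 * t + 1) * π / (2 * m))) ^ (2 * n) := by
    rw [← Finset.Ico_add_one_right_eq_Icc, Finset.sum_Ico_eq_sum_range, add_tsub_cancel_right]
    refine Finset.sum_congr rfl fun t _ => ?_
    rw [show 2 * (1 + t) - 1 = 2 * t + 1 by omega]
    push_cast
    rfl
  have hfull : ∑ t ∈ Finset.range m, (2 * Real.cos ((2 * t + 1) * π / (2 * m))) ^ (2 * n) =
      m * (2 * n).choose n + 2 * (m * ∑ j ∈ (Finset.Icc 1 n).filter (fun j => j * m ≤ n),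
        (-1 : ℝ) ^ j * (2 * n).choose (n + j * m)) := by
    simp only [two_mul_cos_pow_two_mul_eq_sum, ← sum_choose_mul_sum_cos hm0]
    rw [Finset.sum_add_distrib, Finset.sum_const, Finset.card_range, nsmul_eq_mul,
      ← Finset.mul_sum, Finset.sum_comm]
    simp only [Finset.mul_sum]
    congr 1
    refine Finset.sum_congr rfl fun r _ => Finset.sum_congr rfl fun t _ => ?_
    congr 3
    field_simp
  rw [sum_two_mul_cos_pow_half hm0 (by omega), hchoose] at hfull
  rw [hshift, one_div, inv_mul_eq_iff_eq_mul₀ hm']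
  linarith
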